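/- For every integer n ≥ 2, the polynomial p_n(x) = x^{2n} - 2(x + x^2 + ... + x^{2n-1}) + 1 is irreducible over the integers. -/

import Mathlib

open Polynomial

open ComplexConjugate in
/-- The kernel `∑ (w * conj v) ^ j` factors as a rank one kernel on the solutions of
`z ^ m * (z - 3) = 1 - 3 * z`. -/
lemma sum_mul_conj_eq_eight {m : ℕ} {w v : ℂ} (hw : w ^ m * (w - 3) = 1 - 3 * w)
    (hv : v ^ m * (v - 3) = 1 - 3 * v) (hwv : w * conj v ≠ 1) :
    ∑ j ∈ Finset.range m, ((w - 3) * w ^ j) * conj ((v - 3) * v ^ j) = 8 := by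
  have hv' : (conj v) ^ m * (conj v - 3) = 1 - 3 * conj v := by
    simpa [Complex.conj_ofNat] using congrArg conj hv
  have hg := geom_sum_mul (w * conj v) m
  have hsum : ∑ j ∈ Finset.range m, ((w - 3) * w ^ j) * conj ((v - 3) * v ^ j) =
      (w - 3) * (conj v - 3) * ∑ j ∈ Finset.range m, (w * conj v) ^ j := by
    rw [Finset.mul_sum]
    refine Finset.sum_congr rfl fun j _ ↦ ?_
    simp only [map_mul, map_sub, map_pow, Complex.conj_ofNat, mul_pow]
    ring
  refine mul_right_cancel₀ (sub_ne_zero.mpr hwv) ?_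
  rw [hsum, mul_assoc, hg, mul_pow]
  linear_combination (conj v ^ m * (conj v - 3)) * hw + (1 - 3 * w) * hv'

open ComplexConjugate in
lemma eq_of_pow_mul_sub_three {m : ℕ} (hm : 0 < m) {w v : ℂ}
    (hw : w ^ m * (w - 3) = 1 - 3 * w) (hv : v ^ m * (v - 3) = 1 - 3 * v)
    (hw1 : ‖w‖ < 1) (hv1 : ‖v‖ < 1) : w = v := by
  have hne : ∀ {x y : ℂ}, ‖x‖ < 1 → ‖y‖ < 1 → x * conj y ≠ 1 := fun {x y} hx hy h ↦ by
    have h' := congrArg norm h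
    rw [norm_mul, Complex.norm_conj, norm_one] at h'
    nlinarith [norm_nonneg x, norm_nonneg y]
  have key : ∑ j ∈ Finset.range m,
      (Complex.normSq ((w - 3) * w ^ j - (v - 3) * v ^ j) : ℂ) = 0 := by
    have hexp : ∀ a b : ℂ, (Complex.normSq (a - b) : ℂ) =
        a * conj a - a * conj b - (b * conj a - b * conj b) := fun a b ↦ by
      rw [← Complex.mul_conj, map_sub]
      ring
    simp only [hexp, Finset.sum_sub_distrib]
    rw [sum_mul_conj_eq_eight hw hw (hne hw1 hw1), sum_mul_conj_eq_eight hw hv (hne hw1 hv1),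
      sum_mul_conj_eq_eight hv hw (hne hv1 hw1), sum_mul_conj_eq_eight hv hv (hne hv1 hv1)]
    ring
  have key' : ∑ j ∈ Finset.range m, Complex.normSq ((w - 3) * w ^ j - (v - 3) * v ^ j) = 0 := by
    exact_mod_cast key
  have h0 := (Finset.sum_eq_zero_iff_of_nonneg fun j _ ↦ Complex.normSq_nonneg _).mp key' 0
    (Finset.mem_range.mpr hm)
  simpa [sub_eq_zero] using h0

/-- A solution of `w ^ (2 * n) * (w - 3) = 1 - 3 * w` in the open unit disc is a positive real. -/
lemma exists_pos_real_of_norm_lt_one {n : ℕ} (hn : 0 < n) {w : ℂ}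
    (hw : w ^ (2 * n) * (w - 3) = 1 - 3 * w) (hw1 : ‖w‖ < 1) :
    ∃ r : ℝ, 0 < r ∧ r < 1 ∧ w = r := by
  have hconj := eq_of_pow_mul_sub_three (by omega) hw
    (v := (starRingEnd ℂ) w) (by simpa [Complex.conj_ofNat] using congrArg (starRingEnd ℂ) hw) hw1 (by simpa using hw1)
  obtain ⟨r, rfl⟩ := Complex.conj_eq_iff_real.mp hconj.symm
  have hr : r ^ (2 * n) * (r - 3) = 1 - 3 * r := by exact_mod_cast hw
  have hr1 : |r| < 1 := by simpa using hw1
  refine ⟨r, ?_, (abs_lt.mp hr1).2, rfl⟩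
  by_contra! h
  have : 0 ≤ r ^ (2 * n) := (even_two_mul n).pow_nonneg r
  nlinarith

/-- The norm of the constant term of an integer polynomial with leading coefficient `± 1`. -/
lemma prod_norm_roots_eq_one {f : ℤ[X]} (hlc : IsUnit f.leadingCoeff) (h0 : IsUnit (f.coeff 0)) :
    ((f.map (Int.castRingHom ℂ)).roots.map (‖·‖)).prod = 1 := by
  have hinj : Function.Injective (Int.castRingHom ℂ) := Int.cast_injective
  have h := (IsAlgClosed.splits (f.map (Int.castRingHom ℂ))).coeff_zero_eq_leadingCoeff_mul_prod_roots
  have hu : ∀ a : ℤ, IsUnit a → ‖(a : ℂ)‖ = 1 := fun a ha ↦ by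
    rcases Int.isUnit_iff.mp ha with rfl | rfl <;> simp
  have h' := congrArg norm h
  rw [coeff_map, leadingCoeff_map_of_injective hinj] at h'
  simp only [norm_mul, norm_pow, norm_neg, norm_one, one_pow, one_mul, eq_intCast] at h'
  rw [hu _ h0, hu _ hlc, one_mul] at h'
  rw [h']
  exact (map_multiset_prod (normHom (α := ℂ)) _).symm

/-- If a monic-up-to-sign integer polynomial has no root in the open unit disc and constant term
`± 1`, all its roots are on the unit circle. -/
lemma norm_root_eq_one {f : ℤ[X]} (hlc : IsUnit f.leadingCoeff) (h0 : IsUnit (f.coeff 0))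
    (h : ∀ z ∈ (f.map (Int.castRingHom ℂ)).roots, 1 ≤ ‖z‖) :
    ∀ z ∈ (f.map (Int.castRingHom ℂ)).roots, ‖z‖ = 1 := by
  intro z hz
  have hp := prod_norm_roots_eq_one hlc h0
  rw [← Multiset.cons_erase hz, Multiset.map_cons, Multiset.prod_cons] at hp
  have h1 : 1 ≤ (((f.map (Int.castRingHom ℂ)).roots.erase z).map (‖·‖)).prod :=
    Multiset.one_le_prod_map fun a ha ↦ h a (Multiset.mem_of_mem_erase ha)
  have h2 := h z hz
  nlinarith

/-- An integer polynomial `g` cannot be smaller than one in norm, and nonzero, at all the roots of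
an integer polynomial with leading coefficient `± 1`. -/
lemma exists_root_eval_eq_zero {f : ℤ[X]} (g : ℤ[X]) (hlc : IsUnit f.leadingCoeff)
    (hdeg : f.natDegree ≠ 0)
    (h : ∀ z ∈ (f.map (Int.castRingHom ℂ)).roots, ‖(g.map (Int.castRingHom ℂ)).eval z‖ < 1) :
    ∃ z ∈ (f.map (Int.castRingHom ℂ)).roots, (g.map (Int.castRingHom ℂ)).eval z = 0 := by
  have hinj : Function.Injective (Int.castRingHom ℂ) := Int.cast_injective
  have hsplit := IsAlgClosed.splits (f.map (Int.castRingHom ℂ))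
  have hcard : (f.map (Int.castRingHom ℂ)).roots ≠ 0 := fun h0 ↦ hdeg <| by
    rw [← natDegree_map_eq_of_injective hinj, hsplit.natDegree_eq_card_roots, h0,
      Multiset.card_zero]
  have hres := resultant_eq_prod_eval (f.map (Int.castRingHom ℂ)) (g.map (Int.castRingHom ℂ))
    g.natDegree natDegree_map_le hsplit
  rw [resultant_map_map, leadingCoeff_map_of_injective hinj] at hres
  have hnorm := congrArg norm hres
  have hlc' : ‖((Int.castRingHom ℂ) f.leadingCoeff) ^ g.natDegree‖ = 1 := by
    rcases Int.isUnit_iff.mp hlc with h | h <;> simp [h]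
  have hprod : ‖((f.map (Int.castRingHom ℂ)).roots.map
      (eval · (g.map (Int.castRingHom ℂ)))).prod‖ < 1 := by
    generalize (f.map (Int.castRingHom ℂ)).roots = s at h hcard
    induction s using Multiset.induction_on with
    | empty => exact absurd rfl hcard
    | cons a s ih =>
      rw [Multiset.map_cons, Multiset.prod_cons, norm_mul]
      have ha := h a (Multiset.mem_cons_self a s)
      by_cases hs : s = 0
      · simpa [hs] using ha
      · exact mul_lt_one_of_nonneg_of_lt_one_left (norm_nonneg _) ha
          (ih (fun z hz ↦ h z (Multiset.mem_cons_of_mem hz)) hs).le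
  rw [norm_mul, hlc', one_mul] at hnorm
  rw [← hnorm, eq_intCast, Complex.norm_intCast] at hprod
  have hzero : resultant f g = 0 := by
    simp only [natDegree_map_eq_of_injective hinj] at hprod
    exact Int.abs_lt_one_iff.mp (by exact_mod_cast hprod)
  simp only [natDegree_map_eq_of_injective hinj] at hnorm
  rw [hzero, map_zero, norm_zero, eq_comm, norm_eq_zero, Multiset.prod_eq_zero_iff,
    Multiset.mem_map] at hnorm
  exact hnorm

section

variable {n : ℕ}

lemma X_sub_one_mul_sum_Icc (k : ℕ) :
    (X - 1) * ∑ j ∈ Finset.Icc 1 k, X ^ j = (X ^ (k + 1) - X : ℤ[X]) := by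
  induction k with
  | zero => simp
  | succ k ih =>
    rw [Finset.sum_Icc_succ_top (by omega), mul_add, ih]
    ring

lemma X_sub_one_mul_p (hn : 2 ≤ n) :
    (X - 1) * (X ^ (2 * n) - 2 * ∑ j ∈ Finset.Icc 1 (2 * n - 1), X ^ j + 1 : ℤ[X]) =
      X ^ (2 * n) * (X - 3) + 3 * X - 1 := by
  have h := X_sub_one_mul_sum_Icc (2 * n - 1)
  rw [Nat.sub_add_cancel (by omega)] at h
  linear_combination (-2) * h

lemma pow_mul_sub_three_of_root (hn : 2 ≤ n) {f g : ℤ[X]}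
    (hfg : X ^ (2 * n) - 2 * ∑ j ∈ Finset.Icc 1 (2 * n - 1), X ^ j + 1 = f * g) {z : ℂ}
    (hz : aeval z f = 0) : z ^ (2 * n) * (z - 3) = 1 - 3 * z := by
  have h := congrArg (aeval z) (X_sub_one_mul_p hn)
  rw [hfg] at h
  simp only [map_mul, hz, map_add, map_sub, map_pow, aeval_X, map_one, map_ofNat] at h
  linear_combination -h

lemma eval_one_p_ne_zero (hn : 2 ≤ n) :
    aeval (1 : ℂ) (X ^ (2 * n) - 2 * ∑ j ∈ Finset.Icc 1 (2 * n - 1), X ^ j + 1 : ℤ[X]) ≠ 0 := by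
  simp only [map_add, map_sub, map_mul, map_sum, map_pow, aeval_X, map_one, map_ofNat, one_pow,
    Finset.sum_const, Nat.card_Icc, nsmul_eq_mul, mul_one]
  intro h
  have h' : ((2 * n - 1 + 1 - 1 : ℕ) : ℂ) = 1 := by linear_combination (-1 / 2) * h
  have := Nat.cast_eq_one.mp h'
  omega

lemma aeval_derivative_p_neg (hn : 2 ≤ n) {r : ℝ} (h0 : 0 < r) (h1 : r < 1) :
    aeval r (derivative
      (X ^ (2 * n) - 2 * ∑ j ∈ Finset.Icc 1 (2 * n - 1), X ^ j + 1 : ℤ[X])) < 0 := by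
  have hd : aeval r (derivative
      (X ^ (2 * n) - 2 * ∑ j ∈ Finset.Icc 1 (2 * n - 1), X ^ j + 1 : ℤ[X])) =
      2 * n * r ^ (2 * n - 1) - 2 * ∑ j ∈ Finset.Icc 1 (2 * n - 1), j * r ^ (j - 1) := by
    simp [derivative_mul, derivative_X_pow, map_ofNat]
  rw [hd]
  have hsub : ({1, 2 * n - 1} : Finset ℕ) ⊆ Finset.Icc 1 (2 * n - 1) := by
    intro j hj
    simp only [Finset.mem_insert, Finset.mem_singleton] at hj
    simp only [Finset.mem_Icc]
    omega
  have hle := Finset.sum_le_sum_of_subset_of_nonneg (f := fun j : ℕ ↦ (j : ℝ) * r ^ (j - 1)) hsub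
    fun j _ _ ↦ by positivity
  rw [Finset.sum_pair (by omega)] at hle
  have hpow : r ^ (2 * n - 1) ≤ r ^ (2 * n - 1 - 1) :=
    pow_le_pow_of_le_one h0.le h1.le (by omega)
  have hcast : ((2 * n - 1 : ℕ) : ℝ) = 2 * n - 1 := by
    rw [Nat.cast_sub (by omega)]
    push_cast
    ring
  have hn' : (2 : ℝ) ≤ n := by exact_mod_cast hn
  have hpos : 0 < r ^ (2 * n - 1 - 1) := by positivity
  simp only [hcast, Nat.cast_one, Nat.sub_self, pow_zero] at hle
  nlinarith [mul_le_mul_of_nonneg_left hpow (by positivity : (0 : ℝ) ≤ 2 * n)]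

lemma coeff_zero_p (hn : 2 ≤ n) :
    (X ^ (2 * n) - 2 * ∑ j ∈ Finset.Icc 1 (2 * n - 1), X ^ j + 1 : ℤ[X]).coeff 0 = 1 := by
  have h := congrArg (eval 0) (X_sub_one_mul_p hn)
  rw [coeff_zero_eq_eval_zero]
  rw [eval_mul] at h
  simpa [show n ≠ 0 by omega] using h

lemma monic_p (hn : 2 ≤ n) :
    (X ^ (2 * n) - 2 * ∑ j ∈ Finset.Icc 1 (2 * n - 1), X ^ j + 1 : ℤ[X]).Monic := by
  have h1 : (X - 1 : ℤ[X]).Monic := monic_X_sub_C 1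
  refine h1.of_mul_monic_left ?_
  rw [X_sub_one_mul_p hn]
  have h : (X ^ (2 * n) * (X - 3) + 3 * X - 1 : ℤ[X]) =
      X ^ (2 * n) * (X - C 3) + (C 3 * X + C (-1)) := by
    simp only [map_ofNat, map_neg, map_one]
    ring
  rw [h]
  refine ((monic_X_pow _).mul (monic_X_sub_C _)).add_of_left (degree_linear_le.trans_lt ?_)
  rw [degree_mul, degree_X_pow, degree_X_sub_C]
  exact_mod_cast (by omega : 1 < 2 * n + 1)

/-- Every nonconstant factor of the polynomial has a root in the open unit disc. -/
lemma exists_root_norm_lt_one (hn : 2 ≤ n) {f g : ℤ[X]}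
    (hfg : X ^ (2 * n) - 2 * ∑ j ∈ Finset.Icc 1 (2 * n - 1), X ^ j + 1 = f * g)
    (hdeg : f.natDegree ≠ 0) : ∃ z : ℂ, aeval z f = 0 ∧ ‖z‖ < 1 := by
  have hlc : IsUnit f.leadingCoeff := IsUnit.of_mul_eq_one g.leadingCoeff <| by
    rw [← leadingCoeff_mul, ← hfg, (monic_p hn).leadingCoeff]
  have h0 : IsUnit (f.coeff 0) := IsUnit.of_mul_eq_one (g.coeff 0) <| by
    rw [← mul_coeff_zero, ← hfg, coeff_zero_p hn]
  have haeval : ∀ z ∈ (f.map (Int.castRingHom ℂ)).roots, aeval z f = 0 := fun z hz ↦ by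
    simpa [IsRoot.def, eval_map, aeval_def] using (mem_roots'.mp hz).2
  by_contra! hno
  have hcirc := norm_root_eq_one hlc h0 fun z hz ↦ hno z (haeval z hz)
  obtain ⟨z, hz, hz0⟩ := exists_root_eval_eq_zero (X ^ (2 * n - 1) - 1) hlc hdeg <| by
    intro z hz
    have hq := pow_mul_sub_three_of_root hn hfg (haeval z hz)
    have hz1 := hcirc z hz
    obtain ⟨k, hk⟩ : ∃ k, 2 * n = k + 1 := ⟨2 * n - 1, by omega⟩
    rw [hk] at hq ⊢
    have he : z ^ (k + 2) - 1 = 3 * z * (z ^ k - 1) := by linear_combination hq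
    have hnorm := congrArg norm he
    rw [norm_mul, norm_mul, hz1] at hnorm
    have hle : ‖z ^ (k + 2) - 1‖ ≤ 2 := by
      refine (norm_sub_le _ _).trans ?_
      rw [norm_pow, hz1]
      norm_num
    simp only [Nat.add_sub_cancel, Polynomial.map_sub, Polynomial.map_pow, map_X,
      Polynomial.map_one, eval_sub, eval_pow, eval_X, eval_one]
    norm_num at hnorm
    linarith
  have hq := pow_mul_sub_three_of_root hn hfg (haeval z hz)
  obtain ⟨k, hk, hk1⟩ : ∃ k, 2 * n = 2 * k + 1 + 1 ∧ 2 * n - 1 = 2 * k + 1 :=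
    ⟨n - 1, by omega, by omega⟩
  rw [hk1] at hz0
  rw [hk] at hq
  simp only [Polynomial.map_sub, Polynomial.map_pow, map_X, Polynomial.map_one, eval_sub,
    eval_pow, eval_X, eval_one] at hz0
  have hsq : z ^ 2 = 1 := by linear_combination hq - (z ^ 2 - 3 * z) * hz0
  have hone : z = 1 := by
    rw [pow_succ, pow_mul, hsq, one_pow] at hz0
    linear_combination hz0
  apply eval_one_p_ne_zero hn
  rw [hfg, map_mul, ← hone, haeval z hz, zero_mul]

end

theorem p_irreducible (n : ℕ) (hn : 2 ≤ n) :
    Irreducible ((X ^ (2 * n) - 2 * ∑ j ∈ Finset.Icc 1 (2 * n - 1), X ^ j + 1 : ℤ[X])) := by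
  have hmonic := monic_p hn
  refine ⟨fun hu ↦ ?_, fun f g hfg ↦ ?_⟩
  · apply eval_one_p_ne_zero hn
    have h := X_sub_one_mul_p hn
    rw [hmonic.eq_one_of_isUnit hu] at h
    have h' := congrArg (eval 2) h
    have : (2 : ℤ) ^ (2 * n) = 4 := by
      simp only [eval_mul, eval_add, eval_sub, eval_pow, eval_X, eval_one, eval_ofNat] at h'
      linarith
    have h4 : (2 : ℤ) ^ 4 ≤ 2 ^ (2 * n) := pow_le_pow_right₀ (by norm_num) (by omega)
    norm_num [this] at h4
  · have hlc : f.leadingCoeff * g.leadingCoeff = 1 := by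
      rw [← leadingCoeff_mul, ← hfg, hmonic.leadingCoeff]
    have hunit : ∀ q : ℤ[X], IsUnit q.leadingCoeff → q.natDegree = 0 → IsUnit q := by
      intro q hq hd
      rw [eq_C_of_natDegree_eq_zero hd]
      rw [leadingCoeff, hd] at hq
      exact hq.map C
    by_contra! hfgu
    have hgf := hfg.trans (mul_comm f g)
    obtain ⟨w, hwf, hw1⟩ := exists_root_norm_lt_one hn hfg fun h ↦
      hfgu.1 (hunit f (IsUnit.of_mul_eq_one _ hlc) h)
    obtain ⟨v, hvg, hv1⟩ := exists_root_norm_lt_one hn hgf fun h ↦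
      hfgu.2 (hunit g (IsUnit.of_mul_eq_one _ ((mul_comm _ _).trans hlc)) h)
    have hw := pow_mul_sub_three_of_root hn hfg hwf
    obtain rfl := eq_of_pow_mul_sub_three (by omega) hw
      (pow_mul_sub_three_of_root hn hgf hvg) hw1 hv1
    obtain ⟨r, hr0, hr1, rfl⟩ := exists_pos_real_of_norm_lt_one (by omega) hw hw1
    have hreal : ∀ q : ℤ[X], aeval (r : ℂ) q = 0 → aeval r q = 0 := fun q hq ↦ by
      have := aeval_algebraMap_apply ℂ r q
      rw [Complex.coe_algebraMap, hq] at this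
      exact_mod_cast this.symm
    have hneg := aeval_derivative_p_neg hn hr0 hr1
    rw [hfg, derivative_mul, map_add, map_mul, map_mul, hreal f hwf, hreal g hvg] at hneg
    simp at hneg
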